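/- Let f : ℝⁿ × [0,∞) → ℝⁿ satisfy the relaxed QUAD condition with P, Q, m, where P is symmetric positive definite, and let Γ, Γ_d ∈ ℝⁿˣⁿ be such that PΓ_d = diag(γ_{d,1},…,γ_{d,n}) with γ_{d,h} ≥ 0. Then for all x₁, x₂ ∈ ℝⁿ, all t ≥ 0, and all c, c_d ≥ 0, writing e = x₁ − x₂: eᵀ P (f(x₁,t) − f(x₂,t)) − 2c eᵀ P Γ e − 2 c_d Σ_{h=1}^{n} γ_{d,h} |e_h| ≤ (‖Q‖ − 2c λ_min(sym(PΓ))) ‖e‖² + Σ_{h=1}^{n} (m_h − 2 c_d γ_{d,h}) |e_h|. -/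

import Mathlib

open Matrix MeasureTheory
open scoped Kronecker

/-- Euclidean norm of a finite-dimensional real vector. -/
noncomputable def euclNorm {k : Type*} [Fintype k] (v : k → ℝ) : ℝ :=
  Real.sqrt (∑ i, (v i) ^ 2)

/-- Smallest eigenvalue of a symmetric matrix, via Rayleigh quotients. -/
noncomputable def lambdaMin {n : ℕ} (G : Matrix (Fin n) (Fin n) ℝ) : ℝ :=
  sInf {r : ℝ | ∃ v : Fin n → ℝ, v ≠ 0 ∧ v ⬝ᵥ G.mulVec v = r * ∑ i, (v i) ^ 2}

/-- Largest eigenvalue of a symmetric matrix, via Rayleigh quotients. -/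
noncomputable def lambdaMax {n : ℕ} (G : Matrix (Fin n) (Fin n) ℝ) : ℝ :=
  sSup {r : ℝ | ∃ v : Fin n → ℝ, v ≠ 0 ∧ v ⬝ᵥ G.mulVec v = r * ∑ i, (v i) ^ 2}

/-- Second-smallest eigenvalue of a connected-graph Laplacian, via Rayleigh
quotients over the zero-sum subspace (Courant–Fischer). -/
noncomputable def lambda2 {N : ℕ} (L : Matrix (Fin N) (Fin N) ℝ) : ℝ :=
  sInf {r : ℝ | ∃ v : Fin N → ℝ, v ≠ 0 ∧ (∑ i, v i) = 0 ∧
    v ⬝ᵥ L.mulVec v = r * ∑ i, (v i) ^ 2}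

/-- Spectral (ℓ²-operator) norm of a square matrix. -/
noncomputable def specNorm {n : ℕ} (Q : Matrix (Fin n) (Fin n) ℝ) : ℝ :=
  sSup {r : ℝ | ∃ v : Fin n → ℝ, euclNorm v = 1 ∧ r = euclNorm (Q.mulVec v)}

/-- `L` is the Laplacian matrix of a connected undirected graph: symmetric,
positive semidefinite, zero row sums, and `λ₂(L) > 0`. -/
def IsLaplacianConnected {N : ℕ} (L : Matrix (Fin N) (Fin N) ℝ) : Prop :=
  L.IsSymm ∧ (∀ v : Fin N → ℝ, 0 ≤ v ⬝ᵥ L.mulVec v) ∧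
    (∀ i, ∑ j, L i j = 0) ∧ 0 < lambda2 L

/-- The QUAD(P,Q) condition. -/
def QUAD {n : ℕ} (P Q : Matrix (Fin n) (Fin n) ℝ)
    (f : (Fin n → ℝ) → ℝ → (Fin n → ℝ)) : Prop :=
  ∀ x y : Fin n → ℝ, ∀ t : ℝ, 0 ≤ t →
    (x - y) ⬝ᵥ P.mulVec (f x t - f y t) ≤ (x - y) ⬝ᵥ Q.mulVec (x - y)

/-- The relaxed QUAD condition with matrices `P`, `Q` and vector `m`. -/
def RelaxedQUAD {n : ℕ} (P Q : Matrix (Fin n) (Fin n) ℝ) (m : Fin n → ℝ)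
    (f : (Fin n → ℝ) → ℝ → (Fin n → ℝ)) : Prop :=
  ∀ x y : Fin n → ℝ, ∀ t : ℝ, 0 ≤ t →
    (x - y) ⬝ᵥ P.mulVec (f x t - f y t) ≤
      (x - y) ⬝ᵥ Q.mulVec (x - y) + ∑ h, m h * |x h - y h|

/-- The coupling assumption on `g` with matrices `P`, `G` and gain `c`. -/
def CouplingAssumption {n : ℕ} (P G : Matrix (Fin n) (Fin n) ℝ) (c : ℝ)
    (g : (Fin n → ℝ) → (Fin n → ℝ) → ℝ → (Fin n → ℝ)) : Prop :=
  (∀ x : Fin n → ℝ, ∀ t : ℝ, 0 ≤ t → g x x t = 0) ∧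
  (∀ x y : Fin n → ℝ, ∀ t : ℝ, 0 ≤ t → g x y t = - g y x t) ∧
  (∀ x y : Fin n → ℝ, ∀ t : ℝ, 0 ≤ t →
    c * ((x - y) ⬝ᵥ G.mulVec (x - y)) ≤ (y - x) ⬝ᵥ P.mulVec (g x y t))

/-- Symmetric part of a matrix. -/
noncomputable def symPart {n : ℕ} (M : Matrix (Fin n) (Fin n) ℝ) :
    Matrix (Fin n) (Fin n) ℝ := (1 / 2 : ℝ) • (M + M.transpose)

/-- Componentwise sign of a vector, with `sign 0 = 0`. -/
noncomputable def signVec {n : ℕ} (v : Fin n → ℝ) : Fin n → ℝ :=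
  fun h => Real.sign (v h)

theorem euclNorm_eq_norm {k : Type*} [Fintype k] (v : k → ℝ) :
    euclNorm v = ‖WithLp.toLp 2 v‖ := by
  simp [euclNorm, EuclideanSpace.norm_eq]

theorem euclNorm_sq {k : Type*} [Fintype k] (v : k → ℝ) :
    euclNorm v ^ 2 = ∑ i, (v i) ^ 2 :=
  Real.sq_sqrt (Finset.sum_nonneg fun i _ => sq_nonneg (v i))

theorem euclNorm_pos {k : Type*} [Fintype k] {v : k → ℝ} (hv : v ≠ 0) :
    0 < euclNorm v := by
  rw [euclNorm_eq_norm]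
  simpa using hv

theorem abs_dotProduct_le_euclNorm_mul {k : Type*} [Fintype k] (v w : k → ℝ) :
    |v ⬝ᵥ w| ≤ euclNorm v * euclNorm w := by
  have h := abs_real_inner_le_norm (WithLp.toLp 2 w) (WithLp.toLp 2 v)
  rw [EuclideanSpace.inner_toLp_toLp, ← euclNorm_eq_norm, ← euclNorm_eq_norm] at h
  simpa [mul_comm, dotProduct_comm] using h

theorem exists_euclNorm_mulVec_le {n : ℕ} (Q : Matrix (Fin n) (Fin n) ℝ) :
    ∃ K : ℝ, ∀ v, euclNorm (Q *ᵥ v) ≤ K * euclNorm v := by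
  refine ⟨‖Matrix.toEuclideanCLM (𝕜 := ℝ) Q‖, fun v => ?_⟩
  have h := (Matrix.toEuclideanCLM (𝕜 := ℝ) Q).le_opNorm (WithLp.toLp 2 v)
  rwa [Matrix.toEuclideanCLM_toLp, ← euclNorm_eq_norm, ← euclNorm_eq_norm] at h

theorem euclNorm_smul {k : Type*} [Fintype k] (a : ℝ) (v : k → ℝ) :
    euclNorm (a • v) = |a| * euclNorm v := by
  rw [euclNorm_eq_norm, euclNorm_eq_norm, WithLp.toLp_smul, norm_smul, Real.norm_eq_abs]

theorem euclNorm_mulVec_le_specNorm {n : ℕ} (Q : Matrix (Fin n) (Fin n) ℝ)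
    (v : Fin n → ℝ) : euclNorm (Q *ᵥ v) ≤ specNorm Q * euclNorm v := by
  rcases eq_or_ne v 0 with rfl | hv
  · simp [euclNorm]
  have hpos := euclNorm_pos hv
  obtain ⟨K, hK⟩ := exists_euclNorm_mulVec_le Q
  have hbdd : BddAbove {r : ℝ | ∃ v : Fin n → ℝ, euclNorm v = 1 ∧ r = euclNorm (Q *ᵥ v)} := by
    refine ⟨K, ?_⟩
    rintro r ⟨w, hw, rfl⟩
    simpa [hw] using hK w
  have h : euclNorm (Q *ᵥ ((euclNorm v)⁻¹ • v)) ≤ specNorm Q := by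
    refine le_csSup hbdd ⟨_, ?_, rfl⟩
    rw [euclNorm_smul, abs_of_pos (inv_pos.2 hpos), inv_mul_cancel₀ hpos.ne']
  rw [mulVec_smul, euclNorm_smul, abs_of_pos (inv_pos.2 hpos)] at h
  rwa [inv_mul_le_iff₀ hpos, mul_comm] at h

theorem dotProduct_mulVec_le_specNorm {n : ℕ} (Q : Matrix (Fin n) (Fin n) ℝ)
    (v : Fin n → ℝ) : v ⬝ᵥ Q *ᵥ v ≤ specNorm Q * euclNorm v ^ 2 :=
  calc v ⬝ᵥ Q *ᵥ v ≤ euclNorm v * euclNorm (Q *ᵥ v) :=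
        (le_abs_self _).trans (abs_dotProduct_le_euclNorm_mul _ _)
    _ ≤ euclNorm v * (specNorm Q * euclNorm v) :=
        mul_le_mul_of_nonneg_left (euclNorm_mulVec_le_specNorm Q v) (Real.sqrt_nonneg _)
    _ = specNorm Q * euclNorm v ^ 2 := by ring

theorem lambdaMin_mul_le_dotProduct_mulVec {n : ℕ} (G : Matrix (Fin n) (Fin n) ℝ)
    (v : Fin n → ℝ) : lambdaMin G * euclNorm v ^ 2 ≤ v ⬝ᵥ G *ᵥ v := by
  rcases eq_or_ne v 0 with rfl | hv
  · simp [euclNorm]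
  have hpos := pow_pos (euclNorm_pos hv) 2
  have hbdd : BddBelow {r : ℝ | ∃ v : Fin n → ℝ, v ≠ 0 ∧
      v ⬝ᵥ G *ᵥ v = r * ∑ i, (v i) ^ 2} := by
    refine ⟨-specNorm (-G), ?_⟩
    rintro r ⟨w, hw, h⟩
    have hG := dotProduct_mulVec_le_specNorm (-G) w
    rw [neg_mulVec, dotProduct_neg, h, ← euclNorm_sq, ← neg_mul] at hG
    linarith [le_of_mul_le_mul_right hG (pow_pos (euclNorm_pos hw) 2)]
  rw [← le_div_iff₀ hpos]
  refine csInf_le hbdd ⟨v, hv, ?_⟩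
  rw [← euclNorm_sq, div_mul_cancel₀ _ hpos.ne']

theorem dotProduct_symPart_mulVec {n : ℕ} (M : Matrix (Fin n) (Fin n) ℝ)
    (v : Fin n → ℝ) : v ⬝ᵥ symPart M *ᵥ v = v ⬝ᵥ M *ᵥ v := by
  have h : v ⬝ᵥ Mᵀ *ᵥ v = v ⬝ᵥ M *ᵥ v := by
    rw [mulVec_transpose, dotProduct_comm, ← dotProduct_mulVec]
  rw [symPart, smul_mulVec, add_mulVec, dotProduct_smul, dotProduct_add, h, smul_eq_mul]
  ring

/-- The pointwise Lyapunov-decrement estimate for the two-agent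
discontinuous coupling: with `e = x₁ − x₂`,
`eᵀP(f(x₁,t)−f(x₂,t)) − 2c eᵀPΓe − 2c_d Σ_h γ_{d,h}|e_h|
  ≤ (‖Q‖ − 2c λ_min(sym(PΓ))) ‖e‖² + Σ_h (m_h − 2 c_d γ_{d,h}) |e_h|`. -/
theorem two_agents_lyapunov_decrement
    {n : ℕ} (hn : 0 < n)
    (f : (Fin n → ℝ) → ℝ → (Fin n → ℝ))
    (P Q Γ Γd : Matrix (Fin n) (Fin n) ℝ)
    (m γd : Fin n → ℝ)
    (hP : P.PosDef)
    (hf : RelaxedQUAD P Q m f)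
    (hPΓd : P * Γd = Matrix.diagonal γd)
    (hγd0 : ∀ h, 0 ≤ γd h)
    (x1 x2 : Fin n → ℝ) (t : ℝ) (ht : 0 ≤ t)
    (c cd : ℝ) (hc0 : 0 ≤ c) (hcd0 : 0 ≤ cd)
    (e : Fin n → ℝ) (he : e = x1 - x2) :
    e ⬝ᵥ P.mulVec (f x1 t - f x2 t) - 2 * c * (e ⬝ᵥ (P * Γ).mulVec e)
        - 2 * cd * ∑ h, γd h * |e h|
      ≤ (specNorm Q - 2 * c * lambdaMin (symPart (P * Γ))) * (euclNorm e) ^ 2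
        + ∑ h, (m h - 2 * cd * γd h) * |e h| := by
  have h₁ : e ⬝ᵥ P *ᵥ (f x1 t - f x2 t) ≤ e ⬝ᵥ Q *ᵥ e + ∑ h, m h * |e h| := by
    subst he
    exact hf x1 x2 t ht
  have h₂ := dotProduct_mulVec_le_specNorm Q e
  have h₃ := lambdaMin_mul_le_dotProduct_mulVec (symPart (P * Γ)) e
  rw [dotProduct_symPart_mulVec] at h₃
  have h₄ := mul_le_mul_of_nonneg_left h₃ (mul_nonneg zero_le_two hc0)
  have h₅ : ∑ h, (m h - 2 * cd * γd h) * |e h|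
      = ∑ h, m h * |e h| - 2 * cd * ∑ h, γd h * |e h| := by
    rw [Finset.mul_sum, ← Finset.sum_sub_distrib]
    exact Finset.sum_congr rfl fun h _ => by ring
  rw [h₅]
  linarith
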